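/- Fix 0 ≤ j < l and set v := Γ^{det}_j |0⟩ ∈ F. Then: (a) Ĉ_{ab} v = 0 for all a, b ∈ ℤ with a < b, where Ĉ_{ab} := Ê_{ab} − (−1)^{a+b} Ê_{1−b,1−a}; (b) ê*^{pq} v = 0 for all p < q; (c) (Ê_{kk} − Ê_{1−k,1−k}) v = v for 1 ≤ k ≤ 2l−j and (Ê_{kk} − Ê_{1−k,1−k}) v = 0 for k > 2l−j. -/

import Mathlib

/-!
Bosonic Fock space of `l` pairs of bosonic ghost fields indexed by `½ + ℤ`.

The Fock space `BFock l` is the polynomial algebra `ℂ[x^{ε,p}_r]` with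
`ε ∈ {+,-}` (encoded as `Bool`, `true = +`), `1 ≤ p ≤ l` (encoded as `Fin l`) and
`r ∈ ½+ℤ`, `r > 0` (encoded as `n : ℕ` with `r = n + ½`), with vacuum `|0⟩ = 1`.

For `r > 0`, `γ^{ε,p}_{-r}` is multiplication by `x^{ε,p}_r`, while
`γ^{+,p}_{r} = ∂/∂x^{-,p}_r` and `γ^{-,p}_{r} = -∂/∂x^{+,p}_r`.
A general mode `γ^{ε,p}_{k-½}` is encoded by `boson ε p k` for `k : ℤ`.
-/

noncomputable section

/-- Variable index: `(ε, p, n)` corresponds to `x^{ε,p}_{n+½}`. -/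
abbrev BBas (l : ℕ) := Bool × Fin l × ℕ

/-- The bosonic Fock space: the polynomial algebra on the variables `x^{ε,p}_r`. -/
abbrev BFock (l : ℕ) := MvPolynomial (BBas l) ℂ

/-- The vacuum vector `|0⟩ = 1`. -/
def bvac (l : ℕ) : BFock l := 1

/-- Creation operator `γ^{ε,p}_{-(n+½)}`: multiplication by `x^{ε,p}_{n+½}`. -/
def gamCr (l : ℕ) (ε : Bool) (p : Fin l) (n : ℕ) : BFock l → BFock l :=
  fun f => MvPolynomial.X ((ε, p, n) : BBas l) * f

/-- Annihilation operator: `γ^{+,p}_{n+½} = ∂/∂x^{-,p}_{n+½}` and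
`γ^{-,p}_{n+½} = -∂/∂x^{+,p}_{n+½}`. -/
def gamAn (l : ℕ) (ε : Bool) (p : Fin l) (n : ℕ) : BFock l → BFock l :=
  if ε then fun f => MvPolynomial.pderiv ((false, p, n) : BBas l) f
  else fun f => -(MvPolynomial.pderiv ((true, p, n) : BBas l) f)

/-- `boson ε p k` is the mode `γ^{ε,p}_{k-½}`, for `k : ℤ`. -/
def boson (l : ℕ) (ε : Bool) (p : Fin l) (k : ℤ) : BFock l → BFock l :=
  if k ≤ 0 then gamCr l ε p (-k).toNat else gamAn l ε p (k - 1).toNat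

/-- Normal ordered product `:γ^{ε₁,p₁}_{k₁-½} γ^{ε₂,p₂}_{k₂-½}:`, which is `γ₂ γ₁` if
`k₁ - ½ > 0 > k₂ - ½` and `γ₁ γ₂` otherwise. -/
def nGam (l : ℕ) (ε₁ : Bool) (p₁ : Fin l) (k₁ : ℤ) (ε₂ : Bool) (p₂ : Fin l) (k₂ : ℤ) :
    BFock l → BFock l :=
  if 1 ≤ k₁ ∧ k₂ ≤ 0 then fun x => boson l ε₂ p₂ k₂ (boson l ε₁ p₁ k₁ x)
  else fun x => boson l ε₁ p₁ k₁ (boson l ε₂ p₂ k₂ x)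

/-- `Ê_{ij} = -Σ_{p=1}^{l} :γ^{+,p}_{½-i} γ^{-,p}_{j-½}:`. -/
def bEhat (l : ℕ) (i j : ℤ) : BFock l → BFock l :=
  fun x => -(∑ p : Fin l, nGam l true p (1 - i) false p j x)

/-- `ê*^{pq} = Σ_{r∈½+ℤ} :γ^{+,p}_{-r} γ^{-,q}_{r}:` (a locally finite sum; `r = k - ½`). -/
def bestar (l : ℕ) (p q : Fin l) : BFock l → BFock l :=
  fun x => ∑ᶠ k : ℤ, nGam l true p (1 - k) false q k x

/-- `ê^{pq} = Σ_{r∈½+ℤ} :γ^{-,p}_{-r} γ^{-,q}_{r}:`. -/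
def bee (l : ℕ) (p q : Fin l) : BFock l → BFock l :=
  fun x => ∑ᶠ k : ℤ, nGam l false p (1 - k) false q k x

/-- `ê**^{pq} = Σ_{r∈½+ℤ} :γ^{+,p}_{-r} γ^{+,q}_{r}:`. -/
def bestarstar (l : ℕ) (p q : Fin l) : BFock l → BFock l :=
  fun x => ∑ᶠ k : ℤ, nGam l true p (1 - k) true q k x

/-- The polynomial `Γ^{det}_j`: the determinant of the `(2l-j)×(2l-j)` matrix `M` whose
entry in row `r` and column `p` (both 1-indexed, encoded 0-indexed) is `γ^{+,p}_{-r+½}`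
for `1 ≤ p ≤ l`, and `(-1)^{r+1} γ^{-,p-l+j}_{-r+½}` for `l+1 ≤ p ≤ 2l-j`.  All entries
are (signed) multiplications by variables, so the determinant is well defined as the
determinant of the corresponding matrix of polynomials. -/
def PDet (l : ℕ) (j : ℕ) (hj : j < l) : BFock l :=
  (Matrix.of fun r p : Fin (2 * l - j) =>
    if h : (p : ℕ) < l then
      MvPolynomial.X ((true, (⟨(p : ℕ), h⟩ : Fin l), (r : ℕ)) : BBas l)
    else
      (-1 : BFock l) ^ (r : ℕ) *
        MvPolynomial.X
          ((false, (⟨(p : ℕ) - l + j, by have := p.2; omega⟩ : Fin l), (r : ℕ)) :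
            BBas l)).det

/-- `Ĉ_{ab} := Ê_{ab} - (-1)^{a+b} Ê_{1-b,1-a}`. -/
def bChat (l : ℕ) (a b : ℤ) : BFock l → BFock l :=
  fun x => bEhat l a b x - ((-1 : ℂ) ^ (a + b)) • bEhat l (1 - b) (1 - a) x

/-- Finite sums of derivations are computed pointwise. -/
theorem Derivation.sum_apply {R A ι : Type*} [CommSemiring R] [CommSemiring A]
    [Algebra R A] (s : Finset ι) (D : ι → Derivation R A A) (x : A) :
    (∑ i ∈ s, D i) x = ∑ i ∈ s, D i x := by
  induction s using Finset.cons_induction with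
  | empty => simp
  | cons a s ha ih => simp only [Finset.sum_cons, Derivation.add_apply, ih]

/-- A derivation killing every factor of a finite product kills the product. -/
theorem Derivation.map_prod_eq_zero {R A ι : Type*} [CommSemiring R] [CommSemiring A]
    [Algebra R A] (D : Derivation R A A) (s : Finset ι) (f : ι → A)
    (h : ∀ i ∈ s, D (f i) = 0) : D (∏ i ∈ s, f i) = 0 := by
  induction s using Finset.cons_induction with
  | empty => simp
  | cons a s ha ih =>
    rw [Finset.prod_cons, Derivation.leibniz, h a (by simp),
      ih fun i hi => h i (by simp [hi])]
    simp

section DerivationDet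

variable {R A n : Type*} [CommRing R] [CommRing A] [Algebra R A] [Fintype n] [DecidableEq n]

/-- A derivation killing all entries of a matrix kills its determinant. -/
theorem Derivation.map_det_eq_zero (D : Derivation R A A) (M : Matrix n n A)
    (h : ∀ r c, D (M r c) = 0) : D M.det = 0 := by
  rw [Matrix.det_apply, map_sum]
  refine Finset.sum_eq_zero fun σ _ => ?_
  rw [Units.smul_def, map_zsmul, D.map_prod_eq_zero _ _ fun i _ => h _ _, smul_zero]

/-- A derivation killing all entries outside a column acts on the determinant through
that column. -/
theorem Derivation.map_det_of_col (D : Derivation R A A) (M : Matrix n n A) (c₀ : n)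
    (h : ∀ r c, c ≠ c₀ → D (M r c) = 0) :
    D M.det = (M.updateCol c₀ fun r => D (M r c₀)).det := by
  rw [Matrix.det_apply, Matrix.det_apply, map_sum]
  refine Finset.sum_congr rfl fun σ _ => ?_
  rw [Units.smul_def, Units.smul_def, map_zsmul]
  congr 1
  rw [← Finset.mul_prod_erase _ _ (Finset.mem_univ c₀),
    ← Finset.mul_prod_erase _ _ (Finset.mem_univ c₀), Derivation.leibniz,
    D.map_prod_eq_zero _ _ fun i hi => h _ _ (Finset.ne_of_mem_erase hi), smul_zero, zero_add,
    Matrix.updateCol_self, smul_eq_mul, mul_comm]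
  congr 1
  refine Finset.prod_congr rfl fun i hi => ?_
  rw [Matrix.updateCol_ne (Finset.ne_of_mem_erase hi)]

/-- A derivation killing all entries outside a row acts on the determinant through that row. -/
theorem Derivation.map_det_of_row (D : Derivation R A A) (M : Matrix n n A) (r₀ : n)
    (h : ∀ r c, r ≠ r₀ → D (M r c) = 0) :
    D M.det = (M.updateRow r₀ fun c => D (M r₀ c)).det := by
  rw [← Matrix.det_transpose, D.map_det_of_col M.transpose r₀ fun r c hc => h c r hc,
    Matrix.updateCol_transpose, Matrix.det_transpose]
  rfl

/-- Exchanging the new values of two replaced columns changes the sign of the determinant. -/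
theorem Matrix.det_updateCol_updateCol_swap (M : Matrix n n A) {c c' : n} (hc : c ≠ c')
    (u w : n → A) :
    ((M.updateCol c u).updateCol c' w).det = -((M.updateCol c w).updateCol c' u).det := by
  have h := Matrix.det_permute' (Equiv.swap c c') ((M.updateCol c w).updateCol c' u)
  rw [Equiv.Perm.sign_swap hc] at h
  simp only [Units.val_neg, Units.val_one, Int.cast_neg, Int.cast_one, neg_mul, one_mul] at h
  rw [← h]
  congr 1
  ext r i
  by_cases h1 : i = c
  · subst h1
    simp [hc]
  · by_cases h2 : i = c'
    · subst h2
      simp [hc]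
    · simp [h1, h2, Equiv.swap_apply_of_ne_of_ne h1 h2]

end DerivationDet

/-- The modes `Ê_{ij}` with `i, j ≥ 1`. -/
theorem bEhat_pos_pos (l m n : ℕ) (x : BFock l) :
    bEhat l (m + 1) (n + 1) x =
      ∑ p : Fin l, MvPolynomial.X (true, p, m) * MvPolynomial.pderiv (true, p, n) x := by
  have h1 : ¬ (1 : ℤ) ≤ 1 - (m + 1) := by omega
  have h2 : (1 : ℤ) - (m + 1) ≤ 0 := by omega
  have h3 : ¬ (n + 1 : ℤ) ≤ 0 := by omega
  have h4 : (-(1 - (m + 1 : ℤ))).toNat = m := by omega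
  have h5 : ((n + 1 : ℤ) - 1).toNat = n := by omega
  simp only [bEhat, nGam, boson, h1, h2, h3, h4, h5, false_and, if_true, if_false, gamCr, gamAn,
    Bool.false_eq_true, mul_neg, Finset.sum_neg_distrib, neg_neg]

/-- The modes `Ê_{ij}` with `i, j ≤ 0`. -/
theorem bEhat_nonpos_nonpos (l m n : ℕ) (x : BFock l) :
    bEhat l (-n) (-m) x =
      -∑ p : Fin l, MvPolynomial.X (false, p, m) * MvPolynomial.pderiv (false, p, n) x := by
  have h1 : (1 : ℤ) ≤ 1 - -(n : ℤ) := by omega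
  have h2 : ¬ (1 : ℤ) - -(n : ℤ) ≤ 0 := by omega
  have h3 : (-m : ℤ) ≤ 0 := by omega
  have h4 : (1 - -(n : ℤ) - 1).toNat = n := by omega
  have h5 : (- -(m : ℤ)).toNat = m := by omega
  simp only [bEhat, nGam, boson, h1, h2, h3, h4, h5, true_and, if_true, if_false, gamCr, gamAn]

/-- The modes `Ê_{ij}` with `i ≤ 0 < j`. -/
theorem bEhat_nonpos_pos (l m n : ℕ) (x : BFock l) :
    bEhat l (-m) (n + 1) x =
      ∑ p : Fin l, MvPolynomial.pderiv (false, p, m) (MvPolynomial.pderiv (true, p, n) x) := by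
  have h1 : ¬ (1 : ℤ) - -(m : ℤ) ≤ 0 := by omega
  have h3 : ¬ (n + 1 : ℤ) ≤ 0 := by omega
  have h4 : (1 - -(m : ℤ) - 1).toNat = m := by omega
  have h5 : ((n + 1 : ℤ) - 1).toNat = n := by omega
  simp only [bEhat, nGam, boson, h1, h3, h4, h5, and_false, if_true, if_false, gamAn,
    Bool.false_eq_true, map_neg, Finset.sum_neg_distrib, neg_neg]

/-- The matrix whose determinant is `PDet`. -/
def detMatrix (l j : ℕ) (hj : j < l) : Matrix (Fin (2 * l - j)) (Fin (2 * l - j)) (BFock l) :=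
  Matrix.of fun r p =>
    if h : (p : ℕ) < l then
      MvPolynomial.X ((true, (⟨(p : ℕ), h⟩ : Fin l), (r : ℕ)) : BBas l)
    else
      (-1 : BFock l) ^ (r : ℕ) *
        MvPolynomial.X
          ((false, (⟨(p : ℕ) - l + j, by have := p.2; omega⟩ : Fin l), (r : ℕ)) : BBas l)

theorem PDet_eq_det (l j : ℕ) (hj : j < l) : PDet l j hj = (detMatrix l j hj).det := rfl

/-- The column of `detMatrix` carrying the variables `x^{+,p}`. -/
def plusCol (l j : ℕ) (hj : j < l) (p : Fin l) : Fin (2 * l - j) := ⟨p, by omega⟩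

/-- The column of `detMatrix` carrying the variables `x^{-,p}`, for `j ≤ p`. -/
def minusCol (l j : ℕ) (p : Fin l) (hp : j ≤ p) : Fin (2 * l - j) :=
  ⟨l + p - j, by omega⟩

section Entries

variable {l j : ℕ} (hj : j < l)

theorem detMatrix_plusCol (r : Fin (2 * l - j)) (p : Fin l) :
    detMatrix l j hj r (plusCol l j hj p) = MvPolynomial.X (true, p, (r : ℕ)) := by
  simp [detMatrix, plusCol]

theorem detMatrix_minusCol (r : Fin (2 * l - j)) (p : Fin l) (hp : j ≤ p) :
    detMatrix l j hj r (minusCol l j p hp) =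
      (-1) ^ (r : ℕ) * MvPolynomial.X (false, p, (r : ℕ)) := by
  have h1 : ¬ l + (p : ℕ) - j < l := by omega
  have h2 : l + (p : ℕ) - j - l + j = p := by omega
  simp [detMatrix, minusCol, h1, h2]

theorem plusCol_ne_minusCol (p q : Fin l) (hq : j ≤ q) :
    plusCol l j hj p ≠ minusCol l j q hq := by
  simp only [plusCol, minusCol, ne_eq, Fin.mk.injEq]
  omega

theorem eq_plusCol_or_minusCol (c : Fin (2 * l - j)) :
    (∃ p, c = plusCol l j hj p) ∨ ∃ p hp, c = minusCol l j p hp := by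
  by_cases h : (c : ℕ) < l
  · exact Or.inl ⟨⟨c, h⟩, rfl⟩
  · refine Or.inr ⟨⟨c - l + j, by omega⟩, by simp, ?_⟩
    ext
    simp only [minusCol]
    omega

theorem pderiv_true_detMatrix_minusCol (p q : Fin l) (hq : j ≤ q) (n : ℕ)
    (r : Fin (2 * l - j)) :
    MvPolynomial.pderiv (true, p, n) (detMatrix l j hj r (minusCol l j q hq)) = 0 := by
  rw [detMatrix_minusCol]
  rcases neg_one_pow_eq_or (BFock l) r with h | h <;> simp [h, MvPolynomial.pderiv_X]

theorem pderiv_false_detMatrix_plusCol (p q : Fin l) (n : ℕ) (r : Fin (2 * l - j)) :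
    MvPolynomial.pderiv (false, p, n) (detMatrix l j hj r (plusCol l j hj q)) = 0 := by
  simp [detMatrix_plusCol, MvPolynomial.pderiv_X]

theorem pderiv_true_detMatrix_plusCol (p q : Fin l) (n : ℕ) (r : Fin (2 * l - j)) :
    MvPolynomial.pderiv (true, p, n) (detMatrix l j hj r (plusCol l j hj q)) =
      if q = p ∧ (r : ℕ) = n then 1 else 0 := by
  simp [detMatrix_plusCol, MvPolynomial.pderiv_X, Pi.single_apply, eq_comm]

theorem pderiv_false_detMatrix_minusCol (p q : Fin l) (hq : j ≤ q) (n : ℕ)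
    (r : Fin (2 * l - j)) :
    MvPolynomial.pderiv (false, p, n) (detMatrix l j hj r (minusCol l j q hq)) =
      if q = p ∧ (r : ℕ) = n then (-1) ^ n else 0 := by
  rw [detMatrix_minusCol]
  have : (MvPolynomial.pderiv (false, p, n) : Derivation ℂ (BFock l) (BFock l))
      (MvPolynomial.X (false, q, (r : ℕ))) = if q = p ∧ (r : ℕ) = n then 1 else 0 := by
    simp [MvPolynomial.pderiv_X, Pi.single_apply, eq_comm]
  split_ifs at this ⊢ with h
  · rw [← h.2] at this ⊢
    rcases neg_one_pow_eq_or (BFock l) r with h | h <;> simp [h, this]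
  · rcases neg_one_pow_eq_or (BFock l) r with h | h <;> simp [h, this]

end Entries

/-- The derivation replacing the variables of level `n` by signed variables of level `m`. -/
def rowDerivation (l m n : ℕ) : Derivation ℂ (BFock l) (BFock l) :=
  ∑ p : Fin l, ((MvPolynomial.X (true, p, m) : BFock l) • MvPolynomial.pderiv (true, p, n) +
    ((-1 : BFock l) ^ (m + n) * MvPolynomial.X (false, p, m)) •
      MvPolynomial.pderiv (false, p, n))

theorem rowDerivation_apply (l m n : ℕ) (x : BFock l) :
    rowDerivation l m n x =
      ∑ p : Fin l, (MvPolynomial.X (true, p, m) * MvPolynomial.pderiv (true, p, n) x +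
        ((-1) ^ (m + n) * MvPolynomial.X (false, p, m)) *
          MvPolynomial.pderiv (false, p, n) x) := by
  rw [rowDerivation, Derivation.sum_apply]
  rfl

theorem rowDerivation_detMatrix {l j : ℕ} (hj : j < l) (m n : ℕ) (r c : Fin (2 * l - j)) :
    (r : ℕ) ≠ n → rowDerivation l m n (detMatrix l j hj r c) = 0 := by
  intro hr
  rw [rowDerivation_apply]
  refine Finset.sum_eq_zero fun p _ => ?_
  rcases eq_plusCol_or_minusCol hj c with ⟨q, rfl⟩ | ⟨q, hq, rfl⟩
  · simp [pderiv_true_detMatrix_plusCol, pderiv_false_detMatrix_plusCol, hr]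
  · simp [pderiv_true_detMatrix_minusCol, pderiv_false_detMatrix_minusCol, hr]

theorem rowDerivation_detMatrix_self {l j : ℕ} (hj : j < l) (m n c : Fin (2 * l - j)) :
    rowDerivation l m n (detMatrix l j hj n c) = detMatrix l j hj m c := by
  rw [rowDerivation_apply]
  rcases eq_plusCol_or_minusCol hj c with ⟨q, rfl⟩ | ⟨q, hq, rfl⟩
  · simp only [pderiv_true_detMatrix_plusCol, pderiv_false_detMatrix_plusCol]
    simp [detMatrix_plusCol]
  · simp only [pderiv_true_detMatrix_minusCol, pderiv_false_detMatrix_minusCol, mul_zero,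
      zero_add, and_true, mul_ite, Finset.sum_ite_eq,
      Finset.mem_univ, if_true]
    rw [pow_add, detMatrix_minusCol]
    have : ((-1 : BFock l) ^ (n : ℕ)) * (-1) ^ (n : ℕ) = 1 := by
      rw [← mul_pow]; simp
    linear_combination ((-1) ^ (m : ℕ) * MvPolynomial.X (false, q, (m : ℕ))) * this

theorem rowDerivation_PDet_of_le {l j : ℕ} (hj : j < l) (m n : ℕ) (hn : 2 * l - j ≤ n) :
    rowDerivation l m n (PDet l j hj) = 0 := by
  rw [PDet_eq_det]
  exact Derivation.map_det_eq_zero _ _ fun r c => rowDerivation_detMatrix hj m n r c (by omega)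

theorem rowDerivation_PDet {l j : ℕ} (hj : j < l) (m n : Fin (2 * l - j)) :
    rowDerivation l m n (PDet l j hj) =
      ((detMatrix l j hj).updateRow n (detMatrix l j hj m)).det := by
  rw [PDet_eq_det, Derivation.map_det_of_row _ _ n fun r c hr =>
    rowDerivation_detMatrix hj m n r c (Fin.val_ne_of_ne hr)]
  simp only [rowDerivation_detMatrix_self]

theorem rowDerivation_PDet_self {l j : ℕ} (hj : j < l) (n : ℕ) (hn : n < 2 * l - j) :
    rowDerivation l n n (PDet l j hj) = PDet l j hj := by
  rw [rowDerivation_PDet hj ⟨n, hn⟩ ⟨n, hn⟩, Matrix.updateRow_eq_self, PDet_eq_det]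

theorem rowDerivation_PDet_of_lt {l j : ℕ} (hj : j < l) (m n : ℕ) (hmn : m < n) :
    rowDerivation l m n (PDet l j hj) = 0 := by
  by_cases hn : n < 2 * l - j
  · rw [rowDerivation_PDet hj ⟨m, hmn.trans hn⟩ ⟨n, hn⟩]
    exact Matrix.det_updateRow_eq_zero (by simp; omega)
  · exact rowDerivation_PDet_of_le hj m n (by omega)

/-- For `a, b ≥ 1`, the operator `Ĉ_{ab}` is a derivation. -/
theorem bChat_pos_pos (l m n : ℕ) (x : BFock l) :
    bEhat l (m + 1) (n + 1) x -
      ((-1 : ℂ) ^ ((m + 1 : ℤ) + (n + 1))) • bEhat l (1 - (n + 1)) (1 - (m + 1)) x =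
        rowDerivation l m n x := by
  have h1 : (1 : ℤ) - (n + 1) = -n := by ring
  have h2 : (1 : ℤ) - (m + 1) = -m := by ring
  have h3 : (-1 : ℂ) ^ ((m + 1 : ℤ) + (n + 1)) = (-1) ^ (m + n) := by
    rw [show ((m + 1 : ℤ) + (n + 1)) = ((m + n + 2 : ℕ) : ℤ) by push_cast; ring, zpow_natCast,
      pow_add]
    norm_num
  rw [h1, h2, h3, bEhat_pos_pos, bEhat_nonpos_nonpos, rowDerivation_apply,
    Finset.sum_add_distrib, MvPolynomial.smul_eq_C_mul, map_pow, map_neg, map_one, mul_neg,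
    sub_neg_eq_add, Finset.mul_sum]
  simp only [mul_assoc]

section SecondOrder

variable {l j : ℕ} (hj : j < l)

/-- The indicator column of level `n`. -/
def levelCol (l N n : ℕ) : Fin N → BFock l := fun r => if (r : ℕ) = n then 1 else 0

theorem pderiv_true_PDet (p : Fin l) (n : ℕ) :
    MvPolynomial.pderiv (true, p, n) (PDet l j hj) =
      ((detMatrix l j hj).updateCol (plusCol l j hj p) (levelCol l _ n)).det := by
  rw [PDet_eq_det, Derivation.map_det_of_col _ _ (plusCol l j hj p)]
  · simp only [pderiv_true_detMatrix_plusCol, true_and]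
    rfl
  · intro r c hc
    rcases eq_plusCol_or_minusCol hj c with ⟨q, rfl⟩ | ⟨q, hq, rfl⟩
    · rw [pderiv_true_detMatrix_plusCol, if_neg]
      rintro ⟨rfl, -⟩
      exact hc rfl
    · exact pderiv_true_detMatrix_minusCol hj p q hq n r

theorem pderiv_levelCol (i : BBas l) (N n : ℕ) (r : Fin N) :
    MvPolynomial.pderiv i (levelCol l N n r) = 0 := by
  unfold levelCol
  split_ifs <;> simp

theorem pderiv_false_updateCol (p : Fin l) (m n : ℕ) (r c : Fin (2 * l - j))
    (hc : ∀ hp : j ≤ p, c ≠ minusCol l j p hp) :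
    MvPolynomial.pderiv (false, p, m)
      ((detMatrix l j hj).updateCol (plusCol l j hj p) (levelCol l _ n) r c) = 0 := by
  rw [Matrix.updateCol_apply]
  split_ifs
  · exact pderiv_levelCol _ _ _ _
  · rcases eq_plusCol_or_minusCol hj c with ⟨q, rfl⟩ | ⟨q, hq, rfl⟩
    · exact pderiv_false_detMatrix_plusCol hj p q m r
    · rw [pderiv_false_detMatrix_minusCol, if_neg]
      rintro ⟨rfl, -⟩
      exact hc hq rfl

theorem pderiv_false_pderiv_true_PDet_of_lt (p : Fin l) (hp : (p : ℕ) < j) (m n : ℕ) :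
    MvPolynomial.pderiv (false, p, m) (MvPolynomial.pderiv (true, p, n) (PDet l j hj)) = 0 := by
  rw [pderiv_true_PDet]
  exact Derivation.map_det_eq_zero _ _ fun r c =>
    pderiv_false_updateCol hj p m n r c fun h => absurd h (by omega)

theorem pderiv_false_pderiv_true_PDet (p : Fin l) (hp : j ≤ p) (m n : ℕ) :
    MvPolynomial.pderiv (false, p, m) (MvPolynomial.pderiv (true, p, n) (PDet l j hj)) =
      (-1) ^ m * (((detMatrix l j hj).updateCol (plusCol l j hj p) (levelCol l _ n)).updateCol
        (minusCol l j p hp) (levelCol l _ m)).det := by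
  rw [pderiv_true_PDet, Derivation.map_det_of_col _ _ (minusCol l j p hp) fun r c hc =>
    pderiv_false_updateCol hj p m n r c fun _ => hc, ← Matrix.det_updateCol_smul]
  congr 2
  ext1 r
  rw [Matrix.updateCol_ne (plusCol_ne_minusCol hj p p hp).symm, pderiv_false_detMatrix_minusCol]
  simp [levelCol]

theorem pderiv_false_pderiv_true_PDet_symm (p : Fin l) (m n : ℕ) :
    MvPolynomial.pderiv (false, p, m) (MvPolynomial.pderiv (true, p, n) (PDet l j hj)) +
      (-1) ^ (m + n) *
        MvPolynomial.pderiv (false, p, n) (MvPolynomial.pderiv (true, p, m) (PDet l j hj)) =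
      0 := by
  by_cases hp : j ≤ p
  · rw [pderiv_false_pderiv_true_PDet hj p hp, pderiv_false_pderiv_true_PDet hj p hp,
      Matrix.det_updateCol_updateCol_swap _ (plusCol_ne_minusCol hj p p hp), pow_add]
    have : ((-1 : BFock l) ^ n) * (-1) ^ n = 1 := by
      rw [← mul_pow]; simp
    linear_combination ((-1) ^ m * (((detMatrix l j hj).updateCol (plusCol l j hj p)
      (levelCol l _ m)).updateCol (minusCol l j p hp) (levelCol l _ n)).det) * this
  · rw [pderiv_false_pderiv_true_PDet_of_lt hj p (by omega),
      pderiv_false_pderiv_true_PDet_of_lt hj p (by omega)]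
    simp

theorem bChat_nonpos_pos_PDet (m n : ℕ) : bChat l (-m) (n + 1) (PDet l j hj) = 0 := by
  have h1 : (1 : ℤ) - (n + 1) = -n := by ring
  have h2 : (1 : ℤ) - -m = m + 1 := by ring
  have h3 : (-1 : ℂ) ^ ((-m : ℤ) + (n + 1)) = -(-1) ^ (m + n) := by
    rw [show ((-m : ℤ) + (n + 1)) = ((m + n + 1 : ℕ) : ℤ) - 2 * (m : ℤ) by push_cast; ring,
      zpow_sub₀ (by norm_num), zpow_natCast, zpow_mul, pow_add]
    norm_num
  rw [bChat, h1, h2, h3, bEhat_nonpos_pos, bEhat_nonpos_pos, neg_smul, sub_neg_eq_add,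
    MvPolynomial.smul_eq_C_mul, map_pow, map_neg, map_one, Finset.mul_sum,
    ← Finset.sum_add_distrib]
  exact Finset.sum_eq_zero fun p _ => pderiv_false_pderiv_true_PDet_symm hj p m n

end SecondOrder

/-- The symmetry `Ĉ_{ab} = -(-1)^{a+b} Ĉ_{1-b,1-a}`. -/
theorem bChat_symm (l : ℕ) (a b : ℤ) (x : BFock l) :
    bChat l a b x = -((-1 : ℂ) ^ (a + b)) • bChat l (1 - b) (1 - a) x := by
  have h : (-1 : ℂ) ^ (1 - b + (1 - a)) = (-1) ^ (a + b) := by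
    rw [show 1 - b + (1 - a) = (a + b) + 2 * (1 - (a + b)) by ring, zpow_add₀ (by norm_num),
      zpow_mul]
    norm_num
  have h2 : (-1 : ℂ) ^ (a + b) * (-1) ^ (a + b) = 1 := by
    rw [← mul_zpow]; norm_num
  simp only [bChat, h, sub_sub_cancel, neg_smul, smul_sub, smul_smul, neg_mul, h2,
    one_smul]
  abel

theorem bChat_pos_pos_PDet {l j : ℕ} (hj : j < l) (m n : ℕ) (hmn : m < n) :
    bChat l (m + 1) (n + 1) (PDet l j hj) = 0 := by
  rw [bChat, bChat_pos_pos, rowDerivation_PDet_of_lt hj m n hmn]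

theorem bChat_PDet {l j : ℕ} (hj : j < l) (a b : ℤ) (hab : a < b) :
    bChat l a b (PDet l j hj) = 0 := by
  rcases le_or_gt a 0 with ha | ha
  · obtain ⟨m, rfl⟩ : ∃ m : ℕ, a = -m := ⟨(-a).toNat, by omega⟩
    rcases le_or_gt b 0 with hb | hb
    · obtain ⟨n, rfl⟩ : ∃ n : ℕ, b = -n := ⟨(-b).toNat, by omega⟩
      rw [bChat_symm, show (1 : ℤ) - -n = n + 1 by ring, show (1 : ℤ) - -m = m + 1 by ring,
        bChat_pos_pos_PDet hj n m (by omega), smul_zero]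
    · obtain ⟨n, rfl⟩ : ∃ n : ℕ, b = n + 1 := ⟨(b - 1).toNat, by omega⟩
      exact bChat_nonpos_pos_PDet hj m n
  · obtain ⟨m, rfl⟩ : ∃ m : ℕ, a = m + 1 := ⟨(a - 1).toNat, by omega⟩
    obtain ⟨n, rfl⟩ : ∃ n : ℕ, b = n + 1 := ⟨(b - 1).toNat, by omega⟩
    exact bChat_pos_pos_PDet hj m n (by omega)

theorem bEhat_diag_sub (l n : ℕ) (x : BFock l) :
    bEhat l (n + 1) (n + 1) x - bEhat l (1 - (n + 1)) (1 - (n + 1)) x =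
      rowDerivation l n n x := by
  have h := bChat_pos_pos l n n x
  rwa [Even.neg_one_zpow ⟨_, rfl⟩, one_smul] at h

section ColumnOperators

variable {l j : ℕ} (hj : j < l)

/-- The derivation `Σ_n x^{ε,p}_n ∂/∂x^{ε,q}_n` over the first `N` levels. -/
def colDerivation (l N : ℕ) (ε : Bool) (p q : Fin l) : Derivation ℂ (BFock l) (BFock l) :=
  ∑ n ∈ Finset.range N,
    (MvPolynomial.X (ε, p, n) : BFock l) • MvPolynomial.pderiv (ε, q, n)

theorem colDerivation_apply (l N : ℕ) (ε : Bool) (p q : Fin l) (x : BFock l) :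
    colDerivation l N ε p q x =
      ∑ n ∈ Finset.range N, MvPolynomial.X (ε, p, n) * MvPolynomial.pderiv (ε, q, n) x := by
  rw [colDerivation, Derivation.sum_apply]
  rfl

theorem colDerivation_true_PDet (p q : Fin l) (hpq : p ≠ q) :
    colDerivation l (2 * l - j) true p q (PDet l j hj) = 0 := by
  rw [PDet_eq_det, Derivation.map_det_of_col _ _ (plusCol l j hj q)]
  · refine Matrix.det_zero_of_column_eq (i := plusCol l j hj p) (j := plusCol l j hj q) ?_ ?_
    · simpa [plusCol, Fin.ext_iff] using hpq
    · intro r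
      have : plusCol l j hj p ≠ plusCol l j hj q := by
        simpa [plusCol, Fin.ext_iff] using hpq
      rw [Matrix.updateCol_ne this, Matrix.updateCol_self, colDerivation_apply]
      simp only [pderiv_true_detMatrix_plusCol]
      simp [detMatrix_plusCol]
  · intro r c hc
    rw [colDerivation_apply]
    refine Finset.sum_eq_zero fun n _ => ?_
    rcases eq_plusCol_or_minusCol hj c with ⟨s, rfl⟩ | ⟨s, hs, rfl⟩
    · rw [pderiv_true_detMatrix_plusCol, if_neg, mul_zero]
      rintro ⟨rfl, -⟩
      exact hc rfl
    · rw [pderiv_true_detMatrix_minusCol, mul_zero]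

theorem colDerivation_false_detMatrix (p q : Fin l) (r c : Fin (2 * l - j))
    (hc : ∀ hq : j ≤ q, c ≠ minusCol l j q hq) :
    colDerivation l (2 * l - j) false p q (detMatrix l j hj r c) = 0 := by
  rw [colDerivation_apply]
  refine Finset.sum_eq_zero fun n _ => ?_
  rcases eq_plusCol_or_minusCol hj c with ⟨s, rfl⟩ | ⟨s, hs, rfl⟩
  · rw [pderiv_false_detMatrix_plusCol, mul_zero]
  · rw [pderiv_false_detMatrix_minusCol, if_neg, mul_zero]
    rintro ⟨rfl, -⟩
    exact hc hs rfl

theorem colDerivation_false_PDet (p q : Fin l) (hpq : q < p) :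
    colDerivation l (2 * l - j) false p q (PDet l j hj) = 0 := by
  rw [PDet_eq_det]
  by_cases hq : j ≤ q
  · have hp : j ≤ p := hq.trans hpq.le
    have hne : minusCol l j p hp ≠ minusCol l j q hq := by
      simp only [minusCol, ne_eq, Fin.mk.injEq]
      have : (q : ℕ) < p := hpq
      omega
    rw [Derivation.map_det_of_col _ _ (minusCol l j q hq) fun r c hc =>
      colDerivation_false_detMatrix hj p q r c fun _ => hc]
    refine Matrix.det_zero_of_column_eq hne fun r => ?_
    rw [Matrix.updateCol_ne hne, Matrix.updateCol_self, colDerivation_apply]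
    simp only [pderiv_false_detMatrix_minusCol]
    simp [detMatrix_minusCol, mul_comm]
    omega
  · exact Derivation.map_det_eq_zero _ _ fun r c =>
      colDerivation_false_detMatrix hj p q r c fun h => absurd h hq

theorem pderiv_true_PDet_of_le (p : Fin l) (n : ℕ) (hn : 2 * l - j ≤ n) :
    MvPolynomial.pderiv (true, p, n) (PDet l j hj) = 0 := by
  rw [PDet_eq_det]
  refine Derivation.map_det_eq_zero _ _ fun r c => ?_
  rcases eq_plusCol_or_minusCol hj c with ⟨s, rfl⟩ | ⟨s, hs, rfl⟩
  · rw [pderiv_true_detMatrix_plusCol, if_neg (by omega)]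
  · rw [pderiv_true_detMatrix_minusCol]

theorem pderiv_false_PDet_of_le (p : Fin l) (n : ℕ) (hn : 2 * l - j ≤ n) :
    MvPolynomial.pderiv (false, p, n) (PDet l j hj) = 0 := by
  rw [PDet_eq_det]
  refine Derivation.map_det_eq_zero _ _ fun r c => ?_
  rcases eq_plusCol_or_minusCol hj c with ⟨s, rfl⟩ | ⟨s, hs, rfl⟩
  · rw [pderiv_false_detMatrix_plusCol]
  · rw [pderiv_false_detMatrix_minusCol, if_neg (by omega)]

theorem nGam_pos (l : ℕ) (p q : Fin l) (n : ℕ) (x : BFock l) :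
    nGam l true p (1 - (n + 1)) false q (n + 1) x =
      -(MvPolynomial.X (true, p, n) * MvPolynomial.pderiv (true, q, n) x) := by
  have h1 : ¬ (1 : ℤ) ≤ 1 - (n + 1) := by omega
  have h2 : (1 : ℤ) - (n + 1) ≤ 0 := by omega
  have h3 : ¬ (n + 1 : ℤ) ≤ 0 := by omega
  have h4 : (-(1 - (n + 1 : ℤ))).toNat = n := by omega
  have h5 : ((n + 1 : ℤ) - 1).toNat = n := by omega
  simp only [nGam, boson, h1, h2, h3, h4, h5, false_and, if_true, if_false, gamCr, gamAn,
    Bool.false_eq_true, mul_neg]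

theorem nGam_nonpos (l : ℕ) (p q : Fin l) (n : ℕ) (x : BFock l) :
    nGam l true p (1 - -n) false q (-n) x =
      MvPolynomial.X (false, q, n) * MvPolynomial.pderiv (false, p, n) x := by
  have h1 : (1 : ℤ) ≤ 1 - -(n : ℤ) := by omega
  have h2 : ¬ (1 : ℤ) - -(n : ℤ) ≤ 0 := by omega
  have h3 : (-n : ℤ) ≤ 0 := by omega
  have h4 : (1 - -(n : ℤ) - 1).toNat = n := by omega
  have h5 : (- -(n : ℤ)).toNat = n := by omega
  simp only [nGam, boson, h1, h2, h3, h4, h5, true_and, if_true, if_false, gamCr, gamAn]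

/-- A finitely supported sum over `ℤ`, split into positive and nonpositive indices. -/
theorem finsum_int_eq_sum_add_sum {A : Type*} [AddCommMonoid A] (f : ℤ → A) (N : ℕ)
    (hpos : ∀ n : ℕ, N ≤ n → f (n + 1) = 0) (hneg : ∀ n : ℕ, N ≤ n → f (-n) = 0) :
    ∑ᶠ k, f k = ∑ n ∈ Finset.range N, f (n + 1) + ∑ n ∈ Finset.range N, f (-n) := by
  have hd : Disjoint ((Finset.range N).image fun n : ℕ => (n + 1 : ℤ))
      ((Finset.range N).image fun n : ℕ => (-n : ℤ)) := by
    rw [Finset.disjoint_left]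
    simp only [Finset.mem_image, Finset.mem_range, not_exists, not_and]
    rintro _ ⟨a, -, rfl⟩ b -
    omega
  rw [finsum_eq_sum_of_support_subset f (s := ((Finset.range N).image fun n : ℕ => (n + 1 : ℤ)) ∪
    (Finset.range N).image fun n : ℕ => (-n : ℤ)), Finset.sum_union hd,
    Finset.sum_image (by intro a _ b _ h; simpa using h),
    Finset.sum_image (by intro a _ b _ h; simpa using h)]
  intro k hk
  simp only [Finset.coe_union, Finset.coe_image, Set.mem_union, Set.mem_image, Finset.coe_range,
    Set.mem_Iio]
  rcases le_or_gt k 0 with h | h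
  · obtain ⟨n, rfl⟩ : ∃ n : ℕ, k = -n := ⟨(-k).toNat, by omega⟩
    exact Or.inr ⟨n, not_le.mp fun hn => hk (hneg n hn), rfl⟩
  · obtain ⟨n, rfl⟩ : ∃ n : ℕ, k = n + 1 := ⟨(k - 1).toNat, by omega⟩
    exact Or.inl ⟨n, not_le.mp fun hn => hk (hpos n hn), rfl⟩

theorem bestar_PDet (p q : Fin l) (hpq : p < q) : bestar l p q (PDet l j hj) = 0 := by
  rw [bestar, finsum_int_eq_sum_add_sum _ (2 * l - j)]
  · simp only [nGam_pos, nGam_nonpos]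
    rw [Finset.sum_neg_distrib, ← colDerivation_apply, ← colDerivation_apply,
      colDerivation_true_PDet hj p q hpq.ne, colDerivation_false_PDet hj q p hpq, neg_zero,
      add_zero]
  · intro n hn
    rw [nGam_pos, pderiv_true_PDet_of_le hj q n hn, mul_zero, neg_zero]
  · intro n hn
    rw [nGam_nonpos, pderiv_false_PDet_of_le hj p n hn, mul_zero]

end ColumnOperators

/-- for `0 ≤ j < l`, the vector `v = Γ^{det}_j |0⟩` is annihilated by all
`Ĉ_{ab}` with `a < b` and all `ê*^{pq}` with `p < q`, and satisfies
`(Ê_{kk} - Ê_{1-k,1-k}) v = v` for `1 ≤ k ≤ 2l-j` and `= 0` for `k > 2l-j`. -/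
theorem hwvector_det_cinf_bosonic (l : ℕ) (j : ℕ) (hj : j < l)
    (v : BFock l) (hv : v = PDet l j hj) :
    (∀ a b : ℤ, a < b → bChat l a b v = 0) ∧
    (∀ p q : Fin l, p < q → bestar l p q v = 0) ∧
    (∀ k : ℕ, 1 ≤ k → k ≤ 2 * l - j →
      bEhat l (k : ℤ) (k : ℤ) v - bEhat l (1 - (k : ℤ)) (1 - (k : ℤ)) v = v) ∧
    (∀ k : ℤ, (2 * l - j : ℕ) < k →
      bEhat l k k v - bEhat l (1 - k) (1 - k) v = 0) := by
  subst hv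
  refine ⟨fun a b hab => bChat_PDet hj a b hab, fun p q hpq => bestar_PDet hj p q hpq, ?_, ?_⟩
  · intro k hk hkN
    obtain ⟨n, rfl⟩ : ∃ n, k = n + 1 := ⟨k - 1, by omega⟩
    push_cast
    rw [bEhat_diag_sub, rowDerivation_PDet_self hj n (by omega)]
  · intro k hk
    obtain ⟨n, rfl⟩ : ∃ n : ℕ, k = n + 1 := ⟨(k - 1).toNat, by omega⟩
    rw [bEhat_diag_sub, rowDerivation_PDet_of_le hj n n (by omega)]

end
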